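/- Fix a player i and the strategies s_{-i} of all other players. For every node v ∈ V, the function s_i ↦ g^i_v(s_i, s_{-i}) is submodular: for all sets X ⊆ Y ⊆ V and every node u ∈ V ∖ Y, g^i_v(X ∪ {u}, s_{-i}) − g^i_v(X, s_{-i}) ≥ g^i_v(Y ∪ {u}, s_{-i}) − g^i_v(Y, s_{-i}). -/

import Mathlib

open Finset

/-- `seedCount s u` is `m_u(s)`, the number of players that include node `u`
in their seed set. -/
def seedCount {m n : ℕ} (s : Fin m → Finset (Fin n)) (u : Fin n) : ℕ :=
  (Finset.univ.filter (fun j => u ∈ s j)).card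

/-- `seeded s` is `V_s`, the set of nodes seeded by at least one player. -/
def seeded {m n : ℕ} (s : Fin m → Finset (Fin n)) : Finset (Fin n) :=
  Finset.univ.biUnion s

/-- `fPart c ε s i v` is `f^i_v(s) = Σ_{u ∈ s_i} c^u_v / m_u(s) + Σ_{u ∈ V ∖ V_s} ε·c^u_v`. -/
noncomputable def fPart {m n : ℕ} (c : Fin n → Fin n → ℝ) (ε : ℝ) (s : Fin m → Finset (Fin n))
    (i : Fin m) (v : Fin n) : ℝ :=
  (∑ u ∈ s i, c u v / (seedCount s u : ℝ)) + ∑ u ∈ Finset.univ \ seeded s, ε * c u v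

/-- `fTot c ε s v` is `f_v(s) = Σ_{j ∈ M} f^j_v(s)`. -/
noncomputable def fTot {m n : ℕ} (c : Fin n → Fin n → ℝ) (ε : ℝ) (s : Fin m → Finset (Fin n))
    (v : Fin n) : ℝ :=
  ∑ j : Fin m, fPart c ε s j v

/-- `gPart c ε s i v` is `g^i_v(s) = f^i_v(s) / f_v(s)`. -/
noncomputable def gPart {m n : ℕ} (c : Fin n → Fin n → ℝ) (ε : ℝ) (s : Fin m → Finset (Fin n))
    (i : Fin m) (v : Fin n) : ℝ :=
  fPart c ε s i v / fTot c ε s v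

/-- `payoff c ε s i` is the utility `π_i(s) = (1/n) Σ_{v ∈ V} g^i_v(s)`. -/
noncomputable def payoff {m n : ℕ} (c : Fin n → Fin n → ℝ) (ε : ℝ) (s : Fin m → Finset (Fin n))
    (i : Fin m) : ℝ :=
  (1 / (n : ℝ)) * ∑ v : Fin n, gPart c ε s i v

theorem mem_seeded_iff_seedCount_ne_zero {m n : ℕ} (s : Fin m → Finset (Fin n)) (w : Fin n) :
    w ∈ seeded s ↔ seedCount s w ≠ 0 := by
  simp [seeded, seedCount, Finset.card_eq_zero, Finset.filter_eq_empty_iff]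

theorem fPart_eq_sum {m n : ℕ} (c : Fin n → Fin n → ℝ) (ε : ℝ) (s : Fin m → Finset (Fin n))
    (i : Fin m) (v : Fin n) :
    fPart c ε s i v = ∑ w, ((if w ∈ s i then c w v / (seedCount s w : ℝ) else 0) +
      if seedCount s w = 0 then ε * c w v else 0) := by
  have hcompl : Finset.univ \ seeded s = Finset.univ.filter (fun w => seedCount s w = 0) := by
    ext w
    simp [mem_seeded_iff_seedCount_ne_zero]
  rw [fPart, hcompl, Finset.sum_filter, Finset.sum_add_distrib, Finset.sum_ite_mem,
    Finset.univ_inter]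

theorem fTot_eq_sum {m n : ℕ} (c : Fin n → Fin n → ℝ) (ε : ℝ) (s : Fin m → Finset (Fin n))
    (v : Fin n) :
    fTot c ε s v = ∑ w, c w v * if seedCount s w = 0 then m * ε else 1 := by
  simp only [fTot, fPart_eq_sum]
  rw [Finset.sum_comm]
  refine Finset.sum_congr rfl fun w _ => ?_
  have hcount : ∑ j, (if w ∈ s j then c w v / (seedCount s w : ℝ) else 0) =
      seedCount s w * (c w v / seedCount s w) := by
    rw [← Finset.sum_filter, Finset.sum_const, nsmul_eq_mul, seedCount]
  rw [Finset.sum_add_distrib, hcount]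
  split_ifs with h
  · simp [h]
    ring
  · simp
    field_simp

theorem fPart_nonneg {m n : ℕ} {c : Fin n → Fin n → ℝ} (hc : ∀ u v, 0 ≤ c u v) {ε : ℝ}
    (hε : 0 ≤ ε) (s : Fin m → Finset (Fin n)) (i : Fin m) (v : Fin n) :
    0 ≤ fPart c ε s i v :=
  add_nonneg (Finset.sum_nonneg fun w _ => div_nonneg (hc w v) (Nat.cast_nonneg _))
    (Finset.sum_nonneg fun w _ => mul_nonneg hε (hc w v))

theorem fPart_le_fTot {m n : ℕ} {c : Fin n → Fin n → ℝ} (hc : ∀ u v, 0 ≤ c u v) {ε : ℝ}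
    (hε : 0 ≤ ε) (s : Fin m → Finset (Fin n)) (i : Fin m) (v : Fin n) :
    fPart c ε s i v ≤ fTot c ε s v :=
  Finset.single_le_sum (f := fun j => fPart c ε s j v) (fun j _ => fPart_nonneg hc hε s j v)
    (Finset.mem_univ i)

theorem fTot_pos {m n : ℕ} {c : Fin n → Fin n → ℝ} (hc : ∀ u v, 0 ≤ c u v) {ε : ℝ}
    (hmε : 0 < m * ε) (hmε' : m * ε ≤ 1) (s : Fin m → Finset (Fin n)) (v : Fin n)
    (hcsum : ∑ u, c u v = 1) : 0 < fTot c ε s v := by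
  have hle : ∑ w, c w v * (m * ε) ≤ fTot c ε s v := by
    rw [fTot_eq_sum]
    refine Finset.sum_le_sum fun w _ => mul_le_mul_of_nonneg_left ?_ (hc w v)
    split_ifs
    · exact le_rfl
    · exact hmε'
  rw [← Finset.sum_mul, hcsum, one_mul] at hle
  exact hmε.trans_le hle

theorem seedCount_update {m n : ℕ} (s : Fin m → Finset (Fin n)) (i : Fin m)
    (X : Finset (Fin n)) (w : Fin n) :
    seedCount (Function.update s i X) w =
      seedCount (Function.update s i ∅) w + if w ∈ X then 1 else 0 := by
  simp only [seedCount, Finset.card_filter]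
  rw [← Finset.add_sum_erase _ _ (Finset.mem_univ i),
    ← Finset.add_sum_erase Finset.univ
      (fun j => if w ∈ Function.update s i ∅ j then 1 else 0) (Finset.mem_univ i)]
  have hrest : ∑ j ∈ Finset.univ.erase i, (if w ∈ Function.update s i X j then 1 else 0) =
      ∑ j ∈ Finset.univ.erase i, if w ∈ Function.update s i ∅ j then 1 else 0 :=
    Finset.sum_congr rfl fun j hj => by simp [Function.update_of_ne (Finset.ne_of_mem_erase hj)]
  rw [hrest]
  simp [add_comm]

/-- The increase of `f^i_v` when player `i` adds node `w`. -/
noncomputable def fPartGain {m n : ℕ} (c : Fin n → Fin n → ℝ) (ε : ℝ)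
    (s : Fin m → Finset (Fin n)) (i : Fin m) (v w : Fin n) : ℝ :=
  c w v * (1 / ((seedCount (Function.update s i ∅) w : ℝ) + 1) -
    if seedCount (Function.update s i ∅) w = 0 then ε else 0)

/-- The increase of `f_v` when player `i` adds node `w`. -/
noncomputable def fTotGain {m n : ℕ} (c : Fin n → Fin n → ℝ) (ε : ℝ)
    (s : Fin m → Finset (Fin n)) (i : Fin m) (v w : Fin n) : ℝ :=
  c w v * if seedCount (Function.update s i ∅) w = 0 then 1 - m * ε else 0

theorem fPart_update {m n : ℕ} (c : Fin n → Fin n → ℝ) (ε : ℝ) (s : Fin m → Finset (Fin n))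
    (i : Fin m) (v : Fin n) (X : Finset (Fin n)) :
    fPart c ε (Function.update s i X) i v =
      fPart c ε (Function.update s i ∅) i v + ∑ w ∈ X, fPartGain c ε s i v w := by
  rw [fPart_eq_sum, fPart_eq_sum, ← Finset.univ_inter X, ← Finset.sum_ite_mem,
    ← Finset.sum_add_distrib, Finset.univ_inter]
  refine Finset.sum_congr rfl fun w _ => ?_
  rw [seedCount_update s i X w, fPartGain]
  by_cases hw : w ∈ X <;> by_cases hk : seedCount (Function.update s i ∅) w = 0 <;>
    simp [hw, hk] <;> ring

theorem fTot_update {m n : ℕ} (c : Fin n → Fin n → ℝ) (ε : ℝ) (s : Fin m → Finset (Fin n))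
    (i : Fin m) (v : Fin n) (X : Finset (Fin n)) :
    fTot c ε (Function.update s i X) v =
      fTot c ε (Function.update s i ∅) v + ∑ w ∈ X, fTotGain c ε s i v w := by
  rw [fTot_eq_sum, fTot_eq_sum, ← Finset.univ_inter X, ← Finset.sum_ite_mem,
    ← Finset.sum_add_distrib, Finset.univ_inter]
  refine Finset.sum_congr rfl fun w _ => ?_
  rw [seedCount_update s i X w, fTotGain]
  by_cases hw : w ∈ X <;> by_cases hk : seedCount (Function.update s i ∅) w = 0 <;>
    simp [hw, hk]
  ring

theorem fTotGain_nonneg {m n : ℕ} {c : Fin n → Fin n → ℝ} (hc : ∀ u v, 0 ≤ c u v) {ε : ℝ}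
    (hmε : m * ε ≤ 1) (s : Fin m → Finset (Fin n)) (i : Fin m) (v w : Fin n) :
    0 ≤ fTotGain c ε s i v w := by
  refine mul_nonneg (hc w v) ?_
  split_ifs
  · linarith
  · exact le_rfl

theorem fTotGain_le_fPartGain {m n : ℕ} {c : Fin n → Fin n → ℝ} (hc : ∀ u v, 0 ≤ c u v) {ε : ℝ}
    (hε : 0 ≤ ε) (s : Fin m → Finset (Fin n)) (i : Fin m) (v w : Fin n) :
    fTotGain c ε s i v w ≤ fPartGain c ε s i v w := by
  refine mul_le_mul_of_nonneg_left ?_ (hc w v)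
  have hm : (1 : ℝ) ≤ m := by exact_mod_cast i.pos
  split_ifs with hk
  · rw [hk]
    norm_num
    linarith [le_mul_of_one_le_left hε hm]
  · rw [sub_zero]
    positivity

theorem div_sub_div_antitone {F T F' T' a b : ℝ} (hT : 0 < T) (hTT' : T ≤ T')
    (hR' : 0 ≤ T' - F') (hRR' : T' - F' ≤ T - F) (hb : 0 ≤ b) (hba : b ≤ a) :
    (F' + a) / (T' + b) - F' / T' ≤ (F + a) / (T + b) - F / T := by
  have hT' : 0 < T' := hT.trans_le hTT'
  have marginal : ∀ F T : ℝ, 0 < T →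
      (F + a) / (T + b) - F / T = (a - b) / (T + b) + b * (T - F) / (T * (T + b)) := by
    intro F T hT
    have hTb : T + b ≠ 0 := by positivity
    field_simp
    ring
  rw [marginal F T hT, marginal F' T' hT']
  have hab : 0 ≤ a - b := sub_nonneg.2 hba
  have hR : 0 ≤ T - F := hR'.trans hRR'
  gcongr

/-- Fixing a player `i` and the strategies of the other players (via `Function.update s i ·`),
the function `s_i ↦ g^i_v(s_i, s_{-i})` is submodular. -/
theorem gPart_submodular (m n : ℕ) (hm : 2 ≤ m) (hn : 1 ≤ n)
    (c : Fin n → Fin n → ℝ) (hc : ∀ u v, 0 ≤ c u v)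
    (hcsum : ∀ v : Fin n, ∑ u : Fin n, c u v = 1)
    (ε : ℝ) (hε : 0 < ε) (hε' : ε < 1 / (m : ℝ))
    (i : Fin m) (s : Fin m → Finset (Fin n)) (v : Fin n)
    (X Y : Finset (Fin n)) (hXY : X ⊆ Y) (u : Fin n) (hu : u ∉ Y) :
    gPart c ε (Function.update s i (insert u Y)) i v
        - gPart c ε (Function.update s i Y) i v ≤
      gPart c ε (Function.update s i (insert u X)) i v
        - gPart c ε (Function.update s i X) i v := by
  have hm0 : (0 : ℝ) < m := by exact_mod_cast (by omega : 0 < m)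
  have hmε : 0 < m * ε := mul_pos hm0 hε
  have hmε' : m * ε ≤ 1 := by
    rw [lt_div_iff₀ hm0] at hε'
    linarith
  have hb := fTotGain_nonneg hc hmε' s i v
  have hba := fTotGain_le_fPartGain hc hε.le s i v
  have hTX := fTot_pos hc hmε hmε' (Function.update s i X) v (hcsum v)
  have hRY := sub_nonneg.2 (fPart_le_fTot hc hε.le (Function.update s i Y) i v)
  have hF := fPart_update c ε s i v
  have hT := fTot_update c ε s i v
  have hTT : fTot c ε (Function.update s i X) v ≤ fTot c ε (Function.update s i Y) v := by
    rw [hT X, hT Y]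
    gcongr
    exact fun w _ _ => hb w
  have hRR : fTot c ε (Function.update s i Y) v - fPart c ε (Function.update s i Y) i v ≤
      fTot c ε (Function.update s i X) v - fPart c ε (Function.update s i X) i v := by
    have hsum := Finset.sum_le_sum_of_subset_of_nonneg hXY
      (f := fun w => fPartGain c ε s i v w - fTotGain c ε s i v w)
      fun w _ _ => sub_nonneg.2 (hba w)
    simp only [Finset.sum_sub_distrib] at hsum
    rw [hT X, hT Y, hF X, hF Y]
    linarith
  have insertF : ∀ Z : Finset (Fin n), u ∉ Z → fPart c ε (Function.update s i (insert u Z)) i v =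
      fPart c ε (Function.update s i Z) i v + fPartGain c ε s i v u := by
    intro Z hZ
    rw [hF (insert u Z), hF Z, Finset.sum_insert hZ]
    ring
  have insertT : ∀ Z : Finset (Fin n), u ∉ Z → fTot c ε (Function.update s i (insert u Z)) v =
      fTot c ε (Function.update s i Z) v + fTotGain c ε s i v u := by
    intro Z hZ
    rw [hT (insert u Z), hT Z, Finset.sum_insert hZ]
    ring
  have huX : u ∉ X := fun h => hu (hXY h)
  simp only [gPart]
  rw [insertF X huX, insertF Y hu, insertT X huX, insertT Y hu]
  exact div_sub_div_antitone hTX hTT hRY hRR (hb u) (hba u)
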